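/- Define k₁(v,u) = (4π g√(4+g²)/(u₀v₀)) e^{-(u₀+v₀)/2} with u₀ = √(1+|u|²), v₀ = √(1+|v|²), s = 2(u₀v₀ - u·v + 1), g = √(s-4). Then there exists C > 0 such that k₁(v,u) ≤ C e^{-(u₀+v₀)/2} and |∂_{v_j} k₁(v,u)| ≤ C e^{-(u₀+v₀)/3} for all u,v ∈ ℝ³ and j = 1,2,3. -/

import Mathlib

open MeasureTheory Real
open scoped RealInnerProductSpace

noncomputable def energy (v : EuclideanSpace ℝ (Fin 3)) : ℝ := Real.sqrt (1 + ‖v‖ ^ 2)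

noncomputable def relMom (u v : EuclideanSpace ℝ (Fin 3)) : ℝ :=
  Real.sqrt (2 * (energy u * energy v - ⟪u, v⟫ + 1) - 4)

/-- The loss-term kernel `k₁` of the compact part of the linearized collision operator. -/
noncomputable def k1 (v u : EuclideanSpace ℝ (Fin 3)) : ℝ :=
  4 * π * relMom u v * Real.sqrt (4 + relMom u v ^ 2) / (energy u * energy v) *
    Real.exp (-(energy u + energy v) / 2)

lemma energy_sq (v : EuclideanSpace ℝ (Fin 3)) : energy v ^ 2 = 1 + ‖v‖ ^ 2 :=
  Real.sq_sqrt (by positivity)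

lemma one_le_energy (v : EuclideanSpace ℝ (Fin 3)) : 1 ≤ energy v :=
  Real.one_le_sqrt.2 (by nlinarith [sq_nonneg ‖v‖])

lemma norm_le_energy (v : EuclideanSpace ℝ (Fin 3)) : ‖v‖ ≤ energy v :=
  Real.le_sqrt_of_sq_le (by linarith)

lemma abs_inner_add_one_le (u v : EuclideanSpace ℝ (Fin 3)) :
    |⟪u, v⟫| + 1 ≤ energy u * energy v := by
  have h : ‖u‖ * ‖v‖ + 1 ≤ energy u * energy v := by
    rw [energy, energy, ← Real.sqrt_mul (by positivity)]
    apply Real.le_sqrt_of_sq_le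
    nlinarith [sq_nonneg (‖u‖ - ‖v‖)]
  linarith [abs_real_inner_le_norm u v]

/-- The Lorentz product of the two four-momenta `(energy u, u)` and `(energy v, v)`. -/
noncomputable def lorentzProd (u v : EuclideanSpace ℝ (Fin 3)) : ℝ :=
  energy u * energy v - ⟪u, v⟫

lemma one_le_lorentzProd (u v : EuclideanSpace ℝ (Fin 3)) : 1 ≤ lorentzProd u v := by
  unfold lorentzProd
  linarith [abs_inner_add_one_le u v, le_abs_self ⟪u, v⟫]

lemma lorentzProd_le (u v : EuclideanSpace ℝ (Fin 3)) :
    lorentzProd u v ≤ 2 * (energy u * energy v) := by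
  unfold lorentzProd
  linarith [abs_inner_add_one_le u v, neg_abs_le ⟪u, v⟫]

lemma sqrt_lorentzProd_le (u v : EuclideanSpace ℝ (Fin 3)) :
    √(lorentzProd u v ^ 2 - 1) ≤ lorentzProd u v :=
  Real.sqrt_le_iff.2 ⟨by linarith [one_le_lorentzProd u v], by linarith⟩

lemma k1_eq (v u : EuclideanSpace ℝ (Fin 3)) :
    k1 v u = 8 * π * √(lorentzProd u v ^ 2 - 1) / (energy u * energy v) *
      Real.exp (-(energy u + energy v) / 2) := by
  have hX := one_le_lorentzProd u v
  have hg : relMom u v = √(2 * (lorentzProd u v - 1)) := by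
    unfold relMom lorentzProd
    congr 1
    ring
  have h : relMom u v * √(4 + relMom u v ^ 2) = 2 * √(lorentzProd u v ^ 2 - 1) := by
    rw [hg, Real.sq_sqrt (by linarith), ← Real.sqrt_mul (by linarith),
      show 2 * (lorentzProd u v - 1) * (4 + 2 * (lorentzProd u v - 1))
        = 2 ^ 2 * (lorentzProd u v ^ 2 - 1) by ring,
      Real.sqrt_mul (by norm_num), Real.sqrt_sq (by norm_num)]
  rw [k1, mul_assoc (4 * π), h]
  ring

lemma k1_nonneg (v u : EuclideanSpace ℝ (Fin 3)) : 0 ≤ k1 v u := by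
  have := one_le_energy u
  have := one_le_energy v
  rw [k1_eq]
  positivity

lemma k1_le (v u : EuclideanSpace ℝ (Fin 3)) :
    k1 v u ≤ 16 * π * Real.exp (-(energy u + energy v) / 2) := by
  have hu := one_le_energy u
  have hv := one_le_energy v
  rw [k1_eq]
  gcongr
  rw [div_le_iff₀ (by positivity)]
  nlinarith [Real.pi_pos, sqrt_lorentzProd_le u v, lorentzProd_le u v]

/-- The `v`-gradient of the Lorentz product vanishes at least as fast as `√(X ^ 2 - 1)`. -/
lemma norm_smul_sub_smul_le (u v : EuclideanSpace ℝ (Fin 3)) :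
    ‖energy u • v - energy v • u‖ ≤ energy u * √(lorentzProd u v ^ 2 - 1) := by
  have hu := one_le_energy u
  have hX := one_le_lorentzProd u v
  refine (sq_le_sq₀ (norm_nonneg _) (by positivity)).1 ?_
  rw [mul_pow, Real.sq_sqrt (by nlinarith), @norm_sub_sq_real, norm_smul, norm_smul,
    real_inner_smul_left, real_inner_smul_right, real_inner_comm, mul_pow, mul_pow,
    Real.norm_eq_abs, Real.norm_eq_abs, sq_abs, sq_abs, lorentzProd]
  have h1 : ‖u‖ ^ 2 = energy u ^ 2 - 1 := by rw [energy_sq]; ring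
  have h2 : ‖v‖ ^ 2 = energy v ^ 2 - 1 := by rw [energy_sq]; ring
  rw [h1, h2]
  nlinarith [sq_nonneg (energy v * (energy u ^ 2 - 1) - energy u * ⟪u, v⟫)]

lemma hasDerivAt_energy_line (v e : EuclideanSpace ℝ (Fin 3)) :
    HasDerivAt (fun t : ℝ => energy (v + t • e)) (⟪v, e⟫ / energy v) 0 := by
  have hline : HasDerivAt (fun t : ℝ => v + t • e) e 0 := by
    simpa using ((hasDerivAt_id (0 : ℝ)).smul_const e).const_add v
  have h := ((hline.norm_sq).const_add 1).sqrt (by positivity)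
  refine h.congr_deriv ?_
  rw [zero_smul, add_zero, energy]
  field_simp

lemma hasDerivAt_lorentzProd_line (u v e : EuclideanSpace ℝ (Fin 3)) :
    HasDerivAt (fun t : ℝ => lorentzProd u (v + t • e))
      (⟪energy u • v - energy v • u, e⟫ / energy v) 0 := by
  have hline : HasDerivAt (fun t : ℝ => v + t • e) e 0 := by
    simpa using ((hasDerivAt_id (0 : ℝ)).smul_const e).const_add v
  have hi := (hasDerivAt_const (0 : ℝ) u).inner ℝ hline
  have h := ((hasDerivAt_energy_line v e).const_mul (energy u)).sub hi
  have hv : energy v ≠ 0 := by linarith [one_le_energy v]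
  refine h.congr_deriv ?_
  rw [inner_sub_left, real_inner_smul_left, real_inner_smul_left, inner_zero_left]
  field_simp
  ring

/-- If `X` is differentiable with `|X'| ≤ c √(X ^ 2 - 1)`, then `√(X ^ 2 - 1)` has slope at most
`c X`. -/
lemma abs_deriv_sqrt_sq_sub_one_le {X X' c : ℝ} (hX : 1 < X) (h : |X'| ≤ c * √(X ^ 2 - 1)) :
    |2 * X * X' / (2 * √(X ^ 2 - 1))| ≤ c * X := by
  have hS : 0 < √(X ^ 2 - 1) := Real.sqrt_pos.2 (by nlinarith)
  rw [abs_div, abs_mul, abs_of_pos (by positivity : 0 < 2 * √(X ^ 2 - 1)),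
    abs_of_pos (by linarith : 0 < 2 * X), div_le_iff₀ (by positivity)]
  nlinarith

lemma exists_hasDerivAt_k1_line {u v e : EuclideanSpace ℝ (Fin 3)} (he : ‖e‖ = 1)
    (hX : 1 < lorentzProd u v) :
    ∃ d, HasDerivAt (fun t : ℝ => k1 (v + t • e) u) d 0 ∧
      |d| ≤ 8 * π * (2 * energy u + 3) * Real.exp (-(energy u + energy v) / 2) := by
  have ha := one_le_energy u
  have hb := one_le_energy v
  have hX2 := lorentzProd_le u v
  have hSX := sqrt_lorentzProd_le u v
  have hbd := hasDerivAt_energy_line v e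
  have hXd := hasDerivAt_lorentzProd_line u v e
  have hb' : |⟪v, e⟫ / energy v| ≤ 1 := by
    rw [abs_div, abs_of_pos (by linarith : 0 < energy v), div_le_one (by linarith)]
    have := abs_real_inner_le_norm v e
    rw [he, mul_one] at this
    exact this.trans (norm_le_energy v)
  have hX' : |⟪energy u • v - energy v • u, e⟫ / energy v|
      ≤ energy u / energy v * √(lorentzProd u v ^ 2 - 1) := by
    rw [abs_div, abs_of_pos (by linarith : 0 < energy v), div_mul_eq_mul_div]
    gcongr
    have := abs_real_inner_le_norm (energy u • v - energy v • u) e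
    rw [he, mul_one] at this
    exact this.trans (norm_smul_sub_smul_le u v)
  have hS' := abs_deriv_sqrt_sq_sub_one_le hX hX'
  have hSd := ((hXd.pow 2).sub_const 1).sqrt (by simp; nlinarith)
  have hEd := ((hbd.const_add (energy u)).neg.div_const 2).exp
  have hd := ((hSd.const_mul (8 * π)).div (hbd.const_mul (energy u))
    (by simp; constructor <;> linarith)).mul hEd
  simp only [k1_eq]
  refine ⟨_, hd, ?_⟩
  simp only [zero_smul, add_zero, Pi.pow_apply, Nat.cast_ofNat, Nat.add_one_sub_one, pow_one,
    Pi.neg_apply, Pi.div_apply]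
  generalize ⟪v, e⟫ / energy v = b' at *
  generalize ⟪energy u • v - energy v • u, e⟫ / energy v = X' at *
  generalize 2 * lorentzProd u v * X' / (2 * √(lorentzProd u v ^ 2 - 1)) = S' at *
  have hS0 := Real.sqrt_nonneg (lorentzProd u v ^ 2 - 1)
  generalize √(lorentzProd u v ^ 2 - 1) = S at *
  generalize lorentzProd u v = X at *
  generalize energy u = a at *
  generalize energy v = b at *
  have hE := Real.exp_pos (-(a + b) / 2)
  generalize Real.exp (-(a + b) / 2) = E at *
  have hS'2 : |S' / (a * b)| ≤ 2 * a := by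
    rw [abs_div, abs_of_pos (by positivity : 0 < a * b), div_le_iff₀ (by positivity)]
    calc |S'| ≤ a / b * X := hS'
      _ ≤ a / b * (2 * (a * b)) := by gcongr
      _ = 2 * a * (a * 1) := by field_simp
      _ ≤ 2 * a * (a * b) := by gcongr
  have hR : S / (a * b) ≤ 2 := by
    rw [div_le_iff₀ (by positivity)]
    linarith
  have hR0 : 0 ≤ S / (a * b) := by positivity
  have h2 : |S / (a * b) * (b' * (b⁻¹ + 1 / 2))| ≤ 3 := by
    have hbi : b⁻¹ ≤ 1 := inv_le_one_of_one_le₀ hb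
    rw [abs_mul, abs_mul, abs_of_nonneg hR0, abs_of_pos (by positivity : 0 < b⁻¹ + 1 / 2)]
    calc _ ≤ 2 * (1 * (1 + 1 / 2 : ℝ)) := by gcongr
      _ = 3 := by norm_num
  have key : (8 * π * S' * (a * b) - 8 * π * S * (a * b')) / (a * b) ^ 2 * E +
      8 * π * S / (a * b) * (E * (-b' / 2))
      = 8 * π * (S' / (a * b) - S / (a * b) * (b' * (b⁻¹ + 1 / 2))) * E := by
    field_simp
    ring
  rw [key, abs_mul, abs_mul, abs_of_pos hE, abs_of_pos (by positivity : 0 < 8 * π)]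
  gcongr
  exact (abs_sub _ _).trans (add_le_add hS'2 h2)

lemma abs_fderiv_k1_le (u v : EuclideanSpace ℝ (Fin 3)) {e : EuclideanSpace ℝ (Fin 3)}
    (he : ‖e‖ = 1) :
    |fderiv ℝ (fun w => k1 w u) v e|
      ≤ 8 * π * (2 * energy u + 3) * Real.exp (-(energy u + energy v) / 2) := by
  have ha := one_le_energy u
  by_cases hdiff : DifferentiableAt ℝ (fun w => k1 w u) v
  swap
  · rw [fderiv_zero_of_not_differentiableAt hdiff]
    simp only [zero_apply, abs_zero]
    positivity
  rcases (one_le_lorentzProd u v).eq_or_lt with hX | hX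
  · have h0 : k1 v u = 0 := by simp [k1_eq, ← hX]
    have hmin : IsLocalMin (fun w => k1 w u) v :=
      Filter.Eventually.of_forall fun w => by simpa only [h0] using k1_nonneg w u
    rw [hmin.fderiv_eq_zero]
    simp only [zero_apply, abs_zero]
    positivity
  · obtain ⟨d, hd, hle⟩ := exists_hasDerivAt_k1_line he hX
    have hline : HasLineDerivAt ℝ (fun w => k1 w u) d v e := hd
    rwa [← hdiff.lineDeriv_eq_fderiv, hline.lineDeriv]

/-- Pointwise bounds on `k₁` and its `v`-derivatives. -/
theorem k1_bounds :
    ∃ C > 0, ∀ u v : EuclideanSpace ℝ (Fin 3),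
      k1 v u ≤ C * Real.exp (-(energy u + energy v) / 2) ∧
      ∀ j : Fin 3,
        |fderiv ℝ (fun w => k1 w u) v (EuclideanSpace.single j (1 : ℝ))|
          ≤ C * Real.exp (-(energy u + energy v) / 3) := by
  refine ⟨120 * π, by positivity, fun u v => ⟨(k1_le v u).trans ?_, fun j => ?_⟩⟩
  · gcongr
    norm_num
  · refine (abs_fderiv_k1_le u v (by simp)).trans ?_
    have hb := one_le_energy v
    have ha := one_le_energy u
    have hexp := Real.add_one_le_exp ((energy u + energy v) / 6)
    rw [show -(energy u + energy v) / 3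
      = (energy u + energy v) / 6 + -(energy u + energy v) / 2 by ring, Real.exp_add, ← mul_assoc]
    refine mul_le_mul_of_nonneg_right ?_ (Real.exp_pos _).le
    nlinarith [Real.pi_pos]
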